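/- Spike-and-Slab LASSO marginal of the Laplace DSS variant. Let 0<Θ<1 and λ₀, λ₁ > 0, let f_λ(β) = (λ/2)·exp(−λ|β|) denote the Laplace density, and let k(·|β) be a measurable family of probability densities on ℝ such that for every β'∈ℝ the function β ↦ k(β'|β)·f_{λ₁}(β) is integrable and ∫_ℝ k(β'|β)·f_{λ₁}(β) dβ = f_{λ₁}(β') (i.e., the slab kernel has Laplace(λ₁) as invariant density). Define θ(β) = Θ·f_{λ₁}(β)/(Θ·f_{λ₁}(β)+(1−Θ)·f_{λ₀}(β)) and K(β'|β) = (1−θ(β))·f_{λ₀}(β') + θ(β)·k(β'|β). Then for every β'∈ℝ, ∫_ℝ K(β'|β)·[Θ·f_{λ₁}(β)+(1−Θ)·f_{λ₀}(β)] dβ = Θ·f_{λ₁}(β') + (1−Θ)·f_{λ₀}(β'); that is, the Spike-and-Slab LASSO density Θ·f_{λ₁} + (1−Θ)·f_{λ₀} is invariant for the Laplace DSS transition. -/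

import Mathlib

open MeasureTheory Real

/-- Laplace density with rate `lam`. -/
noncomputable def laplacePdf (lam β : ℝ) : ℝ := (lam / 2) * Real.exp (-(lam * |β|))

theorem laplacePdf_pos {lam : ℝ} (hlam : 0 < lam) (β : ℝ) : 0 < laplacePdf lam β := by
  unfold laplacePdf
  positivity

theorem integral_laplacePdf {lam : ℝ} (hlam : 0 < lam) :
    ∫ β : ℝ, laplacePdf lam β = 1 := by
  have h := integral_comp_abs (f := fun x => lam / 2 * Real.exp (-(lam * x)))
  have h' : ∫ x in Set.Ioi (0 : ℝ), Real.exp (-(lam * x)) = lam⁻¹ := by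
    simpa [neg_mul] using integral_exp_mul_Ioi (neg_lt_zero.mpr hlam) 0
  simp only [integral_const_mul, h'] at h
  simp only [laplacePdf, integral_const_mul, h]
  field_simp

theorem integrable_laplacePdf {lam : ℝ} (hlam : 0 < lam) :
    Integrable (laplacePdf lam) :=
  Integrable.of_integral_ne_zero (by simp [integral_laplacePdf hlam])

/-- Spike-and-Slab LASSO marginal of the Laplace DSS variant: if the slab
kernel `k` has `Laplace(λ₁)` as invariant density, then the Spike-and-Slab
LASSO density `Θ·f_{λ₁} + (1−Θ)·f_{λ₀}` is invariant for the Laplace DSS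
transition `K(β'|β) = (1−θ(β))·f_{λ₀}(β') + θ(β)·k(β'|β)` with
`θ(β) = Θ·f_{λ₁}(β)/(Θ·f_{λ₁}(β)+(1−Θ)·f_{λ₀}(β))`. -/
theorem spike_and_slab_lasso_marginal
    (Θ l0 l1 : ℝ) (hΘ0 : 0 < Θ) (hΘ1 : Θ < 1) (hl0 : 0 < l0) (hl1 : 0 < l1)
    (k : ℝ → ℝ → ℝ)  -- `k β' β` is the slab transition density `k(β'|β)`
    (hkmeas : Measurable (Function.uncurry k))
    (hknonneg : ∀ β' β, 0 ≤ k β' β)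
    (hkprob : ∀ β : ℝ, (∫ β' : ℝ, k β' β) = 1)
    (hintegrable : ∀ β' : ℝ, Integrable (fun β : ℝ => k β' β * laplacePdf l1 β))
    (hinv : ∀ β' : ℝ, (∫ β : ℝ, k β' β * laplacePdf l1 β) = laplacePdf l1 β') :
    ∀ β' : ℝ,
      (∫ β : ℝ,
          ((1 - Θ * laplacePdf l1 β / (Θ * laplacePdf l1 β + (1 - Θ) * laplacePdf l0 β)) *
              laplacePdf l0 β' +
            (Θ * laplacePdf l1 β / (Θ * laplacePdf l1 β + (1 - Θ) * laplacePdf l0 β)) *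
              k β' β) *
          (Θ * laplacePdf l1 β + (1 - Θ) * laplacePdf l0 β)) =
        Θ * laplacePdf l1 β' + (1 - Θ) * laplacePdf l0 β' := by
  intro β'
  have hmix (β : ℝ) :
      ((1 - Θ * laplacePdf l1 β / (Θ * laplacePdf l1 β + (1 - Θ) * laplacePdf l0 β)) *
            laplacePdf l0 β' +
          (Θ * laplacePdf l1 β / (Θ * laplacePdf l1 β + (1 - Θ) * laplacePdf l0 β)) *
            k β' β) *
        (Θ * laplacePdf l1 β + (1 - Θ) * laplacePdf l0 β) =
      Θ * (k β' β * laplacePdf l1 β) +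
        (1 - Θ) * laplacePdf l0 β' * laplacePdf l0 β := by
    have hpos : 0 < Θ * laplacePdf l1 β + (1 - Θ) * laplacePdf l0 β :=
      add_pos (mul_pos hΘ0 (laplacePdf_pos hl1 β))
        (mul_pos (sub_pos.mpr hΘ1) (laplacePdf_pos hl0 β))
    field_simp
    ring
  simp_rw [hmix]
  rw [integral_add ((hintegrable β').const_mul Θ)
      ((integrable_laplacePdf hl0).const_mul ((1 - Θ) * laplacePdf l0 β')),
    integral_const_mul, integral_const_mul, hinv β', integral_laplacePdf hl0, mul_one]
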